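/- arXiv:1408.1214 — 4 statements merged into one kernel-verified Lean document; each statement's English description precedes it below -/
import Mathlib

section
/- Let k, h, e₀ be real numbers with h ≠ 0, set u₀(τ) = (k/h²)·(1 + e₀·cos τ) and ω₁ = −3k²/(2h⁴). Then the function u₁g(τ) = (3k³/(2h⁶))·(1 + e₀²/2) − (k³/(2h⁶))·(3 + e₀²)·cos τ − (e₀²k³/(4h⁶))·cos 2τ satisfies u₁g''(τ) + u₁g(τ) = (3k/(2h²))·u₀(τ)² − 2ω₁·u₀''(τ) for all τ ∈ ℝ, satisfies u₁g(0) = 0 and u₁g'(0) = 0, and is periodic with period 2π. -/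
theorem deriv_cos_trig_poly (a b c : ℝ) :
    deriv (fun τ => a - b * Real.cos τ - c * Real.cos (2 * τ)) =
      fun τ => b * Real.sin τ + 2 * c * Real.sin (2 * τ) := by
  funext τ
  have h₂ := ((hasDerivAt_id τ).const_mul 2).cos.const_mul c
  have h₁ := (((Real.hasDerivAt_cos τ).const_mul b).const_sub a).sub h₂
  refine (h₁.congr_deriv ?_).deriv
  simp only [id]
  ring

theorem deriv_sin_trig_poly (b c : ℝ) :
    deriv (fun τ => b * Real.sin τ + 2 * c * Real.sin (2 * τ)) =
      fun τ => b * Real.cos τ + 4 * c * Real.cos (2 * τ) := by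
  funext τ
  have h₂ := ((hasDerivAt_id τ).const_mul 2).sin.const_mul (2 * c)
  have h₁ := ((Real.hasDerivAt_sin τ).const_mul b).add h₂
  refine (h₁.congr_deriv ?_).deriv
  simp only [id]
  ring

/-- With the frequency correction `ω₁ = −3k²/(2h⁴)` eliminating the
secular term, the function `u₁g` solves the coefficient-of-`A` Lindstedt–Poincaré
equation `u₁'' + u₁ = (3k/(2h²))u₀² − 2ω₁u₀''`, has zero initial data, and is
`2π`-periodic. -/
theorem first_order_periodic_solution (k h e₀ : ℝ) (hh : h ≠ 0)
    (u₀ u₁g : ℝ → ℝ) (ω₁ : ℝ)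
    (hu₀ : u₀ = fun τ => (k / h ^ 2) * (1 + e₀ * Real.cos τ))
    (hω₁ : ω₁ = -(3 * k ^ 2) / (2 * h ^ 4))
    (hu₁g : u₁g = fun τ => (3 * k ^ 3 / (2 * h ^ 6)) * (1 + e₀ ^ 2 / 2)
      - (k ^ 3 / (2 * h ^ 6)) * (3 + e₀ ^ 2) * Real.cos τ
      - (e₀ ^ 2 * k ^ 3 / (4 * h ^ 6)) * Real.cos (2 * τ)) :
    (∀ τ : ℝ, deriv (deriv u₁g) τ + u₁g τ =
        (3 * k / (2 * h ^ 2)) * (u₀ τ) ^ 2 - 2 * ω₁ * deriv (deriv u₀) τ) ∧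
    u₁g 0 = 0 ∧ deriv u₁g 0 = 0 ∧ Function.Periodic u₁g (2 * Real.pi) := by
  have hu₀' : u₀ = fun τ => k / h ^ 2 - -(k / h ^ 2 * e₀) * Real.cos τ - 0 * Real.cos (2 * τ) := by
    rw [hu₀]
    funext τ
    ring
  have hd₀ : deriv (deriv u₀) = fun τ => -(k / h ^ 2 * e₀) * Real.cos τ := by
    rw [hu₀', deriv_cos_trig_poly, deriv_sin_trig_poly]
    funext τ
    ring
  have hd₁ := deriv_cos_trig_poly (3 * k ^ 3 / (2 * h ^ 6) * (1 + e₀ ^ 2 / 2))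
    (k ^ 3 / (2 * h ^ 6) * (3 + e₀ ^ 2)) (e₀ ^ 2 * k ^ 3 / (4 * h ^ 6))
  rw [← hu₁g] at hd₁
  refine ⟨fun τ => ?_, ?_, ?_, fun τ => ?_⟩
  · rw [hd₀, hd₁, deriv_sin_trig_poly, hu₀, hu₁g, hω₁]
    simp only [Real.cos_two_mul]
    field_simp
    ring
  · rw [hu₁g]
    simp only [mul_zero, Real.cos_zero]
    field_simp
    ring
  · simp [hd₁]
  · have h₂ : Real.cos (2 * (τ + 2 * Real.pi)) = Real.cos (2 * τ) := by
      rw [Real.cos_two_mul, Real.cos_add_two_pi, Real.cos_two_mul]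
    simp only [hu₁g, Real.cos_add_two_pi, h₂]
end

section
/- Let k, h, e₀ be real numbers with h ≠ 0. Set u₀(τ) = (k/h²)·(1 + e₀·cos τ), u₁g(τ) = (3k³/(2h⁶))·(1 + e₀²/2) − (k³/(2h⁶))·(3 + e₀²)·cos τ − (e₀²k³/(4h⁶))·cos 2τ, and for A ∈ ℝ define ω(A) = 1 − 3Ak²/(2h⁴) and U_A(τ) = u₀(τ) + A·u₁g(τ). Then there exists a constant C ≥ 0, depending only on k, h, e₀, such that for all A ∈ [−1,1] and all τ ∈ ℝ, |ω(A)²·U_A''(τ) + U_A(τ) − (k/h²)·(1 + (3/2)·A·U_A(τ)²)| ≤ C·A². -/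
/-- The second derivative of a trigonometric polynomial with frequencies `0`, `1`, `2`. -/
lemma deriv_deriv_trig_two (a b c : ℝ) :
    deriv (deriv fun τ : ℝ => a + b * Real.cos τ + c * Real.cos (2 * τ)) =
      fun τ => -(b * Real.cos τ) - 4 * c * Real.cos (2 * τ) := by
  have h₂ : ∀ τ : ℝ, HasDerivAt (fun τ : ℝ => 2 * τ) 2 τ := fun τ => by
    simpa using (hasDerivAt_id τ).const_mul 2
  have h : (deriv fun τ : ℝ => a + b * Real.cos τ + c * Real.cos (2 * τ)) =
      fun τ => b * -Real.sin τ + c * (-Real.sin (2 * τ) * 2) :=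
    funext fun τ => ((((Real.hasDerivAt_cos τ).const_mul b).const_add a).add
      ((h₂ τ).cos.const_mul c)).deriv
  rw [h]
  funext τ
  refine (((Real.hasDerivAt_sin τ).neg.const_mul b).add
    (((h₂ τ).sin.neg.mul_const 2).const_mul c)).deriv.trans ?_
  ring

/-- A jointly continuous function of a parameter in `[-1, 1]` and a cosine is bounded. -/
lemma exists_bound_of_continuous_cos {F : ℝ × ℝ → ℝ} (hF : Continuous F) :
    ∃ C : ℝ, 0 ≤ C ∧ ∀ A ∈ Set.Icc (-1 : ℝ) 1, ∀ τ : ℝ, |F (A, Real.cos τ)| ≤ C := by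
  obtain ⟨C, hC⟩ := ((isCompact_Icc (a := (-1 : ℝ)) (b := 1)).prod
    (isCompact_Icc (a := (-1 : ℝ)) (b := 1))).exists_bound_of_continuousOn hF.continuousOn
  have hb : ∀ A ∈ Set.Icc (-1 : ℝ) 1, ∀ τ : ℝ, |F (A, Real.cos τ)| ≤ C := fun A hA τ =>
    hC (A, Real.cos τ) ⟨hA, Real.neg_one_le_cos τ, Real.cos_le_one τ⟩
  exact ⟨C, (abs_nonneg _).trans (hb 0 (by norm_num) 0), hb⟩

/-- First-order validity of the Lindstedt–Poincaré approximation: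
the residual of the truncated expansion `U_A = u₀ + A·u₁g` with frequency
`ω(A) = 1 − 3Ak²/(2h⁴)` in the Binet-type equation is uniformly of order `A²`. -/
theorem lindstedt_poincare_residual (k h e₀ : ℝ) (hh : h ≠ 0)
    (u₀ u₁g : ℝ → ℝ)
    (hu₀ : u₀ = fun τ => (k / h ^ 2) * (1 + e₀ * Real.cos τ))
    (hu₁g : u₁g = fun τ => (3 * k ^ 3 / (2 * h ^ 6)) * (1 + e₀ ^ 2 / 2)
      - (k ^ 3 / (2 * h ^ 6)) * (3 + e₀ ^ 2) * Real.cos τ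
      - (e₀ ^ 2 * k ^ 3 / (4 * h ^ 6)) * Real.cos (2 * τ))
    (ω : ℝ → ℝ) (hω : ω = fun A => 1 - 3 * A * k ^ 2 / (2 * h ^ 4))
    (U : ℝ → ℝ → ℝ) (hU : U = fun A τ => u₀ τ + A * u₁g τ) :
    ∃ C : ℝ, 0 ≤ C ∧ ∀ A ∈ Set.Icc (-1 : ℝ) 1, ∀ τ : ℝ,
      |(ω A) ^ 2 * deriv (deriv (U A)) τ + U A τ
        - (k / h ^ 2) * (1 + (3 / 2) * A * (U A τ) ^ 2)| ≤ C * A ^ 2 := by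
  subst hu₀ hu₁g hω hU
  obtain ⟨p, hp⟩ : ∃ p, p = k / h ^ 2 := ⟨_, rfl⟩
  have hk : k = p * h ^ 2 := by rw [hp]; field_simp
  have h₁ : 3 * k ^ 3 / (2 * h ^ 6) = 3 / 2 * p ^ 3 := by rw [hk]; field_simp
  have h₂ : k ^ 3 / (2 * h ^ 6) = p ^ 3 / 2 := by rw [hk]; field_simp
  have h₃ : e₀ ^ 2 * k ^ 3 / (4 * h ^ 6) = e₀ ^ 2 * p ^ 3 / 4 := by rw [hk]; field_simp
  have h₄ : ∀ A : ℝ, 3 * A * k ^ 2 / (2 * h ^ 4) = 3 / 2 * A * p ^ 2 := fun A => by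
    rw [hk]; field_simp
  simp only [h₁, h₂, h₃, h₄, ← hp]
  -- `v₀`, `v₁` are the expansion terms and `w₀`, `w₁` their second derivatives, in `c = cos τ`.
  let v₀ : ℝ → ℝ := fun c => p * (1 + e₀ * c)
  let w₀ : ℝ → ℝ := fun c => -(p * e₀ * c)
  let v₁ : ℝ → ℝ := fun c => 3 / 2 * p ^ 3 * (1 + e₀ ^ 2 / 2) - p ^ 3 / 2 * (3 + e₀ ^ 2) * c
    - e₀ ^ 2 * p ^ 3 / 4 * (2 * c ^ 2 - 1)
  let w₁ : ℝ → ℝ := fun c => p ^ 3 / 2 * (3 + e₀ ^ 2) * c + e₀ ^ 2 * p ^ 3 * (2 * c ^ 2 - 1)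
  let F : ℝ × ℝ → ℝ := fun x => 9 / 4 * p ^ 4 * w₀ x.2 - 3 * p ^ 2 * w₁ x.2
    + 9 / 4 * p ^ 4 * x.1 * w₁ x.2 - 3 / 2 * p * (2 * v₀ x.2 * v₁ x.2 + x.1 * v₁ x.2 ^ 2)
  have hF : Continuous F := by
    dsimp only [F, v₀, w₀, v₁, w₁]
    fun_prop
  obtain ⟨C, hC₀, hC⟩ := exists_bound_of_continuous_cos hF
  refine ⟨C, hC₀, fun A hA τ => ?_⟩
  have hU : (fun τ => p * (1 + e₀ * Real.cos τ) + A * (3 / 2 * p ^ 3 * (1 + e₀ ^ 2 / 2)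
      - p ^ 3 / 2 * (3 + e₀ ^ 2) * Real.cos τ - e₀ ^ 2 * p ^ 3 / 4 * Real.cos (2 * τ))) =
      fun τ => (p + A * (3 / 2 * p ^ 3 * (1 + e₀ ^ 2 / 2)))
        + (p * e₀ - A * (p ^ 3 / 2 * (3 + e₀ ^ 2))) * Real.cos τ
        + (-(A * (e₀ ^ 2 * p ^ 3 / 4))) * Real.cos (2 * τ) := by
    funext τ
    ring
  rw [hU, deriv_deriv_trig_two]
  calc _ = |F (A, Real.cos τ) * A ^ 2| := by
        congr 1
        simp only [F, v₀, w₀, v₁, w₁, Real.cos_two_mul]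
        ring
    _ = |F (A, Real.cos τ)| * A ^ 2 := by rw [abs_mul, abs_of_nonneg (sq_nonneg A)]
    _ ≤ C * A ^ 2 := by gcongr; exact hC A hA τ
end

section
/- Let G, M, R, J₂, m₁, m₂ > 0 and l₁, l₂ > 0. For i = 1, 2 set ε₁ = −1, ε₂ = +1, and for (r, z, ψ, φ) with r > l₁ + l₂ define ρ_i(r,z,ψ,φ) = √(r² + z² + l_i² + 2ε_i·l_i·(z·cos φ + r·sin φ·sin ψ)), ζ_i(r,z,ψ,φ) = (z + ε_i·l_i·cos φ)/ρ_i, and the potential U(r,z,ψ,φ) = −GM·Σ_{i=1,2} (m_i/ρ_i)·(1 − J₂·(R/ρ_i)²·(3ζ_i² − 1)/2). Then for every r > l₁ + l₂ and every ψ ∈ ℝ, the partial derivatives of U with respect to z and with respect to φ both vanish at the point (r, 0, ψ, π/2): ∂U/∂z(r, 0, ψ, π/2) = 0 and ∂U/∂φ(r, 0, ψ, π/2) = 0. -/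
/-- The gravitational potential (truncated at the second zonal harmonic `J₂`, with
`P₂(u) = (3u² − 1)/2`) experienced by a dumbbell of masses `m₁, m₂` at distances
`l₁, l₂` from its center of mass, in the field of a nearly spherical body of mass `M`
and equatorial radius `R`; here `(r, z)` are cylindrical coordinates of the dumbbell's
center, `φ` is the nutation angle and `ψ = Θ − θ`. -/
noncomputable def dumbbellPotential (G M R J₂ m₁ m₂ l₁ l₂ : ℝ) (r z ψ φ : ℝ) : ℝ :=
  let ρ₁ := Real.sqrt (r ^ 2 + z ^ 2 + l₁ ^ 2
    + 2 * (-1 : ℝ) * l₁ * (z * Real.cos φ + r * Real.sin φ * Real.sin ψ))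
  let ρ₂ := Real.sqrt (r ^ 2 + z ^ 2 + l₂ ^ 2
    + 2 * (1 : ℝ) * l₂ * (z * Real.cos φ + r * Real.sin φ * Real.sin ψ))
  let ζ₁ := (z + (-1 : ℝ) * l₁ * Real.cos φ) / ρ₁
  let ζ₂ := (z + (1 : ℝ) * l₂ * Real.cos φ) / ρ₂;
  -(G * M) * ((m₁ / ρ₁) * (1 - J₂ * (R / ρ₁) ^ 2 * (3 * ζ₁ ^ 2 - 1) / 2)
    + (m₂ / ρ₂) * (1 - J₂ * (R / ρ₂) ^ 2 * (3 * ζ₂ ^ 2 - 1) / 2))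

/-- A function symmetric about `a` has zero derivative at `a`. -/
lemma deriv_eq_zero_of_reflection {f : ℝ → ℝ} {a : ℝ} (h : ∀ x, f (2 * a - x) = f x) :
    deriv f a = 0 := by
  have hd := deriv_comp_const_sub f (2 * a) a
  rw [funext h, show 2 * a - a = a by ring] at hd
  linarith

/-- The potential is invariant under reflection in the equatorial plane. -/
lemma dumbbellPotential_reflection (G M R J₂ m₁ m₂ l₁ l₂ r z ψ φ : ℝ) :
    dumbbellPotential G M R J₂ m₁ m₂ l₁ l₂ r (-z) ψ (Real.pi - φ)
      = dumbbellPotential G M R J₂ m₁ m₂ l₁ l₂ r z ψ φ := by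
  have neg_add_mul_neg (e c : ℝ) : -z + e * -c = -(z + e * c) := by ring
  simp only [dumbbellPotential, Real.cos_pi_sub, Real.sin_pi_sub, neg_mul_neg, neg_sq,
    neg_add_mul_neg, neg_div]

/-- At the equatorial-plane configuration `z = 0`, `φ = π/2`, the
partial derivatives of the dumbbell potential with respect to `z` and to `φ` vanish.
This is the key computational lemma behind the invariance of the equatorial plane. -/
theorem equatorial_partials_vanish (G M R J₂ m₁ m₂ l₁ l₂ : ℝ)
    (hG : 0 < G) (hM : 0 < M) (hR : 0 < R) (hJ₂ : 0 < J₂)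
    (hm₁ : 0 < m₁) (hm₂ : 0 < m₂) (hl₁ : 0 < l₁) (hl₂ : 0 < l₂) :
    ∀ r : ℝ, l₁ + l₂ < r → ∀ ψ : ℝ,
      deriv (fun z => dumbbellPotential G M R J₂ m₁ m₂ l₁ l₂ r z ψ (Real.pi / 2)) 0 = 0 ∧
      deriv (fun φ => dumbbellPotential G M R J₂ m₁ m₂ l₁ l₂ r 0 ψ φ) (Real.pi / 2) = 0 := by
  intro r _ ψ
  constructor <;> refine deriv_eq_zero_of_reflection fun x => ?_
  · rw [← dumbbellPotential_reflection G M R J₂ m₁ m₂ l₁ l₂ r x ψ (Real.pi / 2)]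
    ring_nf
  · rw [← dumbbellPotential_reflection G M R J₂ m₁ m₂ l₁ l₂ r 0 ψ x]
    ring_nf
end

section
/- Let G, M, R, J₂, m₁, m₂ > 0, l₁, l₂ > 0, set m_s = m₁ + m₂, μ = m₁m₂/m_s, l = l₁ + l₂, and let P_λ ∈ ℝ. Let U(r,z,ψ,φ) = −GM·Σ_{i=1,2} (m_i/ρ_i)·(1 − J₂·(R/ρ_i)²·(3ζ_i² − 1)/2) with ε₁ = −1, ε₂ = +1, ρ_i = √(r² + z² + l_i² + 2ε_i·l_i·(z·cos φ + r·sin φ·sin ψ)) and ζ_i = (z + ε_i·l_i·cos φ)/ρ_i, and let U₁(r,ψ) = U(r, 0, ψ, π/2). Suppose (r, ψ, P_r, P_ψ) : I → ℝ⁴ is continuously differentiable with r > l on I and satisfies the reduced Hamiltonian system dr/dt = P_r/m_s, dP_r/dt = (P_ψ − P_λ)²/(m_s·r³) − ∂U₁/∂r, dψ/dt = (P_ψ − P_λ)/(m_s·r²) + P_ψ/(μl²), dP_ψ/dt = −∂U₁/∂ψ. Then the curve t ↦ (r(t), z(t) = 0, ψ(t), φ(t) = π/2, P_r(t), P_z(t)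 = 0, P_ψ(t), P_φ(t) = 0) is a solution of the full Hamiltonian system with Hamiltonian H = (1/(2m_s))·(P_r² + (P_ψ − P_λ)²/r² + P_z²) + (1/(2μl²))·(P_ψ²/sin²φ + P_φ²) + U(r, z, ψ, φ). In particular, the set {z = 0, P_z = 0, φ = π/2, P_φ = 0} is invariant for the dynamics. -/
/-- The reduced Hamiltonian (A.1) of the dumbbell satellite, in the variables
`(r, z, ψ, φ)` with conjugate momenta `(P_r, P_z, P_ψ, P_φ)` and conserved momentum
`P_λ` of the cyclic variable `λ`. -/
noncomputable def dumbbellHamiltonian (G M R J₂ m₁ m₂ l₁ l₂ m_s μ l Plam : ℝ)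
    (r z ψ φ Pr Pz Pψ Pφ : ℝ) : ℝ :=
  (1 / (2 * m_s)) * (Pr ^ 2 + (Pψ - Plam) ^ 2 / r ^ 2 + Pz ^ 2)
    + (1 / (2 * μ * l ^ 2)) * (Pψ ^ 2 / (Real.sin φ) ^ 2 + Pφ ^ 2)
    + dumbbellPotential G M R J₂ m₁ m₂ l₁ l₂ r z ψ φ

theorem deriv_eq_zero_of_comp_const_sub {f : ℝ → ℝ} {a c : ℝ} (hc : a - c = c)
    (hf : ∀ x, f (a - x) = f x) : deriv f c = 0 := by
  have h := deriv_comp_const_sub f a c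
  simp only [hf, hc] at h
  linarith

theorem dumbbellHamiltonian_neg_z (G M R J₂ m₁ m₂ l₁ l₂ m_s μ l Plam r z ψ Pr Pz Pψ Pφ : ℝ) :
    dumbbellHamiltonian G M R J₂ m₁ m₂ l₁ l₂ m_s μ l Plam r (-z) ψ (Real.pi / 2) Pr Pz Pψ Pφ
      = dumbbellHamiltonian G M R J₂ m₁ m₂ l₁ l₂ m_s μ l Plam r z ψ (Real.pi / 2)
        Pr Pz Pψ Pφ := by
  simp [dumbbellHamiltonian, dumbbellPotential, div_pow]

theorem dumbbellHamiltonian_pi_sub (G M R J₂ m₁ m₂ l₁ l₂ m_s μ l Plam r ψ φ Pr Pz Pψ Pφ : ℝ) :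
    dumbbellHamiltonian G M R J₂ m₁ m₂ l₁ l₂ m_s μ l Plam r 0 ψ (Real.pi - φ) Pr Pz Pψ Pφ
      = dumbbellHamiltonian G M R J₂ m₁ m₂ l₁ l₂ m_s μ l Plam r 0 ψ φ Pr Pz Pψ Pφ := by
  simp [dumbbellHamiltonian, dumbbellPotential, div_pow]

theorem sq_add_sq_add_mul_sin_pos {r a ψ : ℝ} (ha : 0 < a) (har : a < r) :
    0 < r ^ 2 + a ^ 2 + 2 * a * (r * Real.sin ψ) := by
  have h := mul_nonneg (mul_pos ha (ha.trans har)).le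
    (by linarith [Real.neg_one_le_sin ψ] : 0 ≤ Real.sin ψ + 1)
  nlinarith [pow_pos (sub_pos.2 har) 2]

theorem sq_add_sq_sub_mul_sin_pos {r a ψ : ℝ} (ha : 0 < a) (har : a < r) :
    0 < r ^ 2 + a ^ 2 + -(2 * a * (r * Real.sin ψ)) := by
  simpa using sq_add_sq_add_mul_sin_pos (ψ := -ψ) ha har

theorem differentiableAt_dumbbellPotential_radius (G M R J₂ m₁ m₂ : ℝ) {l₁ l₂ r : ℝ} (ψ : ℝ)
    (hl₁ : 0 < l₁) (hl₂ : 0 < l₂) (h₁ : l₁ < r) (h₂ : l₂ < r) :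
    DifferentiableAt ℝ
      (fun x => dumbbellPotential G M R J₂ m₁ m₂ l₁ l₂ x 0 ψ (Real.pi / 2)) r := by
  have p₁ := sq_add_sq_sub_mul_sin_pos (ψ := ψ) hl₁ h₁
  have p₂ := sq_add_sq_add_mul_sin_pos (ψ := ψ) hl₂ h₂
  have q₁ := (Real.sqrt_pos.2 p₁).ne'
  have q₂ := (Real.sqrt_pos.2 p₂).ne'
  have d₁ : DifferentiableAt ℝ
      (fun x => √(x ^ 2 + l₁ ^ 2 + -(2 * l₁ * (x * Real.sin ψ)))) r :=
    DifferentiableAt.sqrt (by fun_prop) p₁.ne'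
  have d₂ : DifferentiableAt ℝ
      (fun x => √(x ^ 2 + l₂ ^ 2 + 2 * l₂ * (x * Real.sin ψ))) r :=
    DifferentiableAt.sqrt (by fun_prop) p₂.ne'
  simp only [dumbbellPotential, Real.cos_pi_div_two, Real.sin_pi_div_two, mul_zero, zero_add,
    mul_one, mul_neg, neg_mul, zero_div, ne_eq, OfNat.ofNat_ne_zero, not_false_eq_true,
    zero_pow, add_zero]
  fun_prop (disch := assumption)

/-- Appendix theorem of the paper. A solution of the reduced
Hamiltonian system in `(r, ψ, P_r, P_ψ)`, with restricted potential
`U₁(r,ψ) = U(r, 0, ψ, π/2)`, extends by `z ≡ 0`, `P_z ≡ 0`, `φ ≡ π/2`, `P_φ ≡ 0` to a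
solution of the full Hamiltonian system; in particular the set
`{z = 0, P_z = 0, φ = π/2, P_φ = 0}` is invariant for the dynamics. -/
theorem equatorial_manifold_invariant (G M R J₂ m₁ m₂ l₁ l₂ : ℝ)
    (hG : 0 < G) (hM : 0 < M) (hR : 0 < R) (hJ₂ : 0 < J₂)
    (hm₁ : 0 < m₁) (hm₂ : 0 < m₂) (hl₁ : 0 < l₁) (hl₂ : 0 < l₂)
    (m_s μ l Plam : ℝ) (hms : m_s = m₁ + m₂) (hμ : μ = m₁ * m₂ / m_s) (hl : l = l₁ + l₂)
    (I : Set ℝ) (r ψ Pr Pψ : ℝ → ℝ) (hrl : ∀ t ∈ I, l < r t)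
    (U₁ : ℝ → ℝ → ℝ)
    (hU₁ : U₁ = fun x y => dumbbellPotential G M R J₂ m₁ m₂ l₁ l₂ x 0 y (Real.pi / 2))
    (hsys : ∀ t ∈ I,
      HasDerivAt r (Pr t / m_s) t ∧
      HasDerivAt Pr ((Pψ t - Plam) ^ 2 / (m_s * (r t) ^ 3)
        - deriv (fun x => U₁ x (ψ t)) (r t)) t ∧
      HasDerivAt ψ ((Pψ t - Plam) / (m_s * (r t) ^ 2) + Pψ t / (μ * l ^ 2)) t ∧
      HasDerivAt Pψ (-(deriv (fun y => U₁ (r t) y) (ψ t))) t) :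
    ∀ t ∈ I,
      HasDerivAt r (deriv (fun p => dumbbellHamiltonian G M R J₂ m₁ m₂ l₁ l₂ m_s μ l Plam
        (r t) 0 (ψ t) (Real.pi / 2) p 0 (Pψ t) 0) (Pr t)) t ∧
      HasDerivAt (fun _ : ℝ => (0 : ℝ))
        (deriv (fun p => dumbbellHamiltonian G M R J₂ m₁ m₂ l₁ l₂ m_s μ l Plam
          (r t) 0 (ψ t) (Real.pi / 2) (Pr t) p (Pψ t) 0) 0) t ∧
      HasDerivAt ψ (deriv (fun p => dumbbellHamiltonian G M R J₂ m₁ m₂ l₁ l₂ m_s μ l Plam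
        (r t) 0 (ψ t) (Real.pi / 2) (Pr t) 0 p 0) (Pψ t)) t ∧
      HasDerivAt (fun _ : ℝ => Real.pi / 2)
        (deriv (fun p => dumbbellHamiltonian G M R J₂ m₁ m₂ l₁ l₂ m_s μ l Plam
          (r t) 0 (ψ t) (Real.pi / 2) (Pr t) 0 (Pψ t) p) 0) t ∧
      HasDerivAt Pr (-(deriv (fun x => dumbbellHamiltonian G M R J₂ m₁ m₂ l₁ l₂ m_s μ l Plam
        x 0 (ψ t) (Real.pi / 2) (Pr t) 0 (Pψ t) 0) (r t))) t ∧
      HasDerivAt (fun _ : ℝ => (0 : ℝ))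
        (-(deriv (fun x => dumbbellHamiltonian G M R J₂ m₁ m₂ l₁ l₂ m_s μ l Plam
          (r t) x (ψ t) (Real.pi / 2) (Pr t) 0 (Pψ t) 0) 0)) t ∧
      HasDerivAt Pψ (-(deriv (fun x => dumbbellHamiltonian G M R J₂ m₁ m₂ l₁ l₂ m_s μ l Plam
        (r t) 0 x (Real.pi / 2) (Pr t) 0 (Pψ t) 0) (ψ t))) t ∧
      HasDerivAt (fun _ : ℝ => (0 : ℝ))
        (-(deriv (fun x => dumbbellHamiltonian G M R J₂ m₁ m₂ l₁ l₂ m_s μ l Plam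
          (r t) 0 (ψ t) x (Pr t) 0 (Pψ t) 0) (Real.pi / 2))) t := by
  intro t ht
  obtain ⟨hr, hPr, hψ, hPψ⟩ := hsys t ht
  have hlt := hrl t ht
  have hms0 : m_s ≠ 0 := by rw [hms]; positivity
  have hl0 : l ≠ 0 := by rw [hl]; positivity
  have hμ0 : μ ≠ 0 := by rw [hμ]; positivity
  have hr0 : r t ≠ 0 := by linarith
  subst hU₁
  refine ⟨?_, ?_, ?_, ?_, ?_, ?_, ?_, ?_⟩
  · convert hr using 1
    have h := (((((hasDerivAt_id (Pr t)).pow 2).add_const ((Pψ t - Plam) ^ 2 / r t ^ 2)).add_const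
      ((0 : ℝ) ^ 2)).const_mul (1 / (2 * m_s))).add_const
        ((1 / (2 * μ * l ^ 2)) * (Pψ t ^ 2 / Real.sin (Real.pi / 2) ^ 2 + (0 : ℝ) ^ 2)) |>.add_const
        (dumbbellPotential G M R J₂ m₁ m₂ l₁ l₂ (r t) 0 (ψ t) (Real.pi / 2))
    refine (show deriv _ (Pr t) = _ from h.deriv).trans ?_
    simp
    field_simp
  · refine (hasDerivAt_const t (0 : ℝ)).congr_deriv (Eq.symm ?_)
    refine deriv_eq_zero_of_comp_const_sub (a := 0) (c := 0) (by simp) fun x => ?_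
    simp [dumbbellHamiltonian]
  · convert hψ using 1
    have h := (((((((hasDerivAt_id (Pψ t)).sub_const Plam).pow 2).div_const (r t ^ 2)).const_add
      (Pr t ^ 2)).add_const ((0 : ℝ) ^ 2)).const_mul (1 / (2 * m_s))).add
      (((((hasDerivAt_id (Pψ t)).pow 2).div_const (Real.sin (Real.pi / 2) ^ 2)).add_const
        ((0 : ℝ) ^ 2)).const_mul (1 / (2 * μ * l ^ 2))) |>.add_const
        (dumbbellPotential G M R J₂ m₁ m₂ l₁ l₂ (r t) 0 (ψ t) (Real.pi / 2))
    refine (show deriv _ (Pψ t) = _ from h.deriv).trans ?_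
    simp
    field_simp
  · refine (hasDerivAt_const t (Real.pi / 2)).congr_deriv (Eq.symm ?_)
    refine deriv_eq_zero_of_comp_const_sub (a := 0) (c := 0) (by simp) fun x => ?_
    simp [dumbbellHamiltonian]
  · convert hPr using 1
    have hU := (differentiableAt_dumbbellPotential_radius G M R J₂ m₁ m₂ (ψ t) hl₁ hl₂
      (by linarith : l₁ < r t) (by linarith : l₂ < r t)).hasDerivAt
    have hK := (((((hasDerivAt_const (r t) ((Pψ t - Plam) ^ 2)).div
      ((hasDerivAt_id (r t)).pow 2) (pow_ne_zero 2 hr0)).const_add (Pr t ^ 2)).add_const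
        ((0 : ℝ) ^ 2)).const_mul (1 / (2 * m_s))).add_const
      ((1 / (2 * μ * l ^ 2)) * (Pψ t ^ 2 / Real.sin (Real.pi / 2) ^ 2 + (0 : ℝ) ^ 2))
    refine (congrArg Neg.neg (show deriv _ (r t) = _ from (hK.add hU).deriv)).trans ?_
    simp
    field_simp
    ring
  · refine (hasDerivAt_const t (0 : ℝ)).congr_deriv (Eq.symm ?_)
    rw [neg_eq_zero]
    refine deriv_eq_zero_of_comp_const_sub (a := 0) (c := 0) (by simp) fun x => ?_
    rw [zero_sub, dumbbellHamiltonian_neg_z]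
  · simpa only [dumbbellHamiltonian, deriv_const_add'] using hPψ
  · refine (hasDerivAt_const t (0 : ℝ)).congr_deriv (Eq.symm ?_)
    rw [neg_eq_zero]
    refine deriv_eq_zero_of_comp_const_sub (a := Real.pi) (c := Real.pi / 2) (by ring) fun x => ?_
    rw [dumbbellHamiltonian_pi_sub]
end
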